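/- Let σ and τ be 2-patterns of the same length r with σ₁ = 1 and τ₁ = 2. Then for every integer n ≥ r one has the identity: Σ_{π ∈ Π_n} occ_σ(π) + Σ_{π ∈ Π_n} occ_τ(π) = C(n,r)·(B_{n+2−r} − B_{n+1−r}), where C(n,r) is a binomial coefficient. -/

import Mathlib

open scoped Classical

def seg (n : ℕ) : Finset ℕ := Finset.Icc 1 n

def IsPartition (P : Finset (Finset ℕ)) (S : Finset ℕ) : Prop :=
  ∅ ∉ P ∧ (∀ B ∈ P, ∀ C ∈ P, B ≠ C → Disjoint B C) ∧ P.biUnion id = S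

noncomputable def partitions (n : ℕ) : Finset (Finset (Finset ℕ)) :=
  ((seg n).powerset.powerset).filter fun P => IsPartition P (seg n)

noncomputable def partitionsK (n k : ℕ) : Finset (Finset (Finset ℕ)) :=
  (partitions n).filter fun P => P.card = k

noncomputable def bell (n : ℕ) : ℕ := (partitions n).card

noncomputable def stirling (n k : ℕ) : ℕ := (partitionsK n k).card

/-- `(i, j)` is an edge of the set partition `P`. -/
def IsEdge (P : Finset (Finset ℕ)) (i j : ℕ) : Prop :=
  i < j ∧ ∃ B ∈ P, i ∈ B ∧ j ∈ B ∧ ∀ p ∈ B, ¬(i < p ∧ p < j)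

/-- `crol P`: number of linear crossings. -/
noncomputable def crol (P : Finset (Finset ℕ)) : ℕ :=
  Nat.card {e : (ℕ × ℕ) × ℕ × ℕ //
    IsEdge P e.1.1 e.1.2 ∧ IsEdge P e.2.1 e.2.2 ∧
      e.1.1 < e.2.1 ∧ e.2.1 < e.1.2 ∧ e.1.2 < e.2.2}

/-- `(i, j)` is a circular edge of `P`. -/
def IsCircEdge (P : Finset (Finset ℕ)) (i j : ℕ) : Prop :=
  IsEdge P i j ∨
    ∃ B ∈ P, ∃ h : B.Nonempty, 2 ≤ B.card ∧ i = B.min' h ∧ j = B.max' h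

/-- `croc P`: number of circular crossings. -/
noncomputable def croc (P : Finset (Finset ℕ)) : ℕ :=
  Nat.card {e : (ℕ × ℕ) × ℕ × ℕ //
    IsCircEdge P e.1.1 e.1.2 ∧ IsCircEdge P e.2.1 e.2.2 ∧
      e.1.1 < e.2.1 ∧ e.2.1 < e.1.2 ∧ e.1.2 < e.2.2}

/-- Two blocks overlap: `min B < min B' < max B < max B'`. -/
def Overlap (B B' : Finset ℕ) : Prop :=
  ∃ (h : B.Nonempty) (h' : B'.Nonempty),
    B.min' h < B'.min' h' ∧ B'.min' h' < B.max' h ∧ B.max' h < B'.max' h'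

/-- `ov P`: number of (unordered) pairs of blocks of `P` that overlap. -/
noncomputable def ov (P : Finset (Finset ℕ)) : ℕ :=
  Nat.card {p : Finset ℕ × Finset ℕ // p.1 ∈ P ∧ p.2 ∈ P ∧ Overlap p.1 p.2}

/-- Two blocks embrace: `min B < min B' ≤ max B' < max B`. -/
def Embrace (B B' : Finset ℕ) : Prop :=
  ∃ (h : B.Nonempty) (h' : B'.Nonempty),
    B.min' h < B'.min' h' ∧ B'.min' h' ≤ B'.max' h' ∧ B'.max' h' < B.max' h

noncomputable def emb (P : Finset (Finset ℕ)) : ℕ :=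
  Nat.card {p : Finset ℕ × Finset ℕ // p.1 ∈ P ∧ p.2 ∈ P ∧ Embrace p.1 p.2}

/-- The block of `P` containing `i`. -/
noncomputable def blockOf (P : Finset (Finset ℕ)) (i : ℕ) : Finset ℕ :=
  (P.filter fun B => i ∈ B).biUnion id

/-- The restricted growth function of `P`: `rgf P i = j` iff `i` lies in the `j`-th
block of `P`, the blocks being ordered by increasing minima. -/
noncomputable def rgf (P : Finset (Finset ℕ)) (i : ℕ) : ℕ :=
  (P.filter fun B => B.min ≤ (blockOf P i).min).card

/-- A 2-pattern: a word on `{1,2}` containing both letters. -/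
def TwoPattern {r : ℕ} (σ : Fin r → ℕ) : Prop :=
  (∀ t, σ t = 1 ∨ σ t = 2) ∧ (∃ t, σ t = 1) ∧ (∃ t, σ t = 2)

/-- `occ n σ P`: number of occurrences of the 2-pattern `σ` in the partition `P` of `[n]`. -/
noncomputable def occ (n : ℕ) {r : ℕ} (σ : Fin r → ℕ) (P : Finset (Finset ℕ)) : ℕ :=
  Nat.card {i : Fin r → ℕ // StrictMono i ∧ (∀ t, i t ∈ seg n) ∧
    ∃ a b : ℕ, a < b ∧
      ∀ t, (σ t = 1 → rgf P (i t) = a) ∧ (σ t = 2 → rgf P (i t) = b)}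

/-- Carlitz `q`-Stirling polynomials. -/
noncomputable def qS : ℕ → ℕ → Polynomial ℚ
  | 0, 0 => 1
  | 0, _ + 1 => 0
  | _ + 1, 0 => 0
  | n + 1, k + 1 =>
      Polynomial.X ^ k * qS n k +
        (∑ i ∈ Finset.range (k + 1), Polynomial.X ^ i) * qS n (k + 1)

/-- Standardization: the order preserving bijection `S → [|S|]`. -/
def stdMap (S : Finset ℕ) (a : ℕ) : ℕ := (S.filter fun x => x ≤ a).card

/-- The standardized 2-block partition obtained from two blocks `A, B`. -/
def stdPair (A B : Finset ℕ) : Finset (Finset ℕ) :=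
  {A.image (stdMap (A ∪ B)), B.image (stdMap (A ∪ B))}

namespace Setoid

instance finite_of_finite {α : Type*} [Finite α] : Finite (Setoid α) :=
  Finite.of_injective (fun (s : Setoid α) (x y : α) => s x y)
    fun _ _ h => Setoid.ext fun x y => iff_of_eq (congrFun (congrFun h x) y)

/-- Pulling back along a surjection `f` identifies the equivalence relations on its codomain with
those on its domain which contain the kernel of `f`. -/
noncomputable def comapEquivOfSurjective {α β : Type*} (f : α → β) (hf : Function.Surjective f) :
    Setoid β ≃ {s : Setoid α // ∀ x y, f x = f y → s x y} where
  toFun t := ⟨t.comap f, fun x y h => by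
    rw [Setoid.comap_rel, h]⟩
  invFun s := s.1.comap (Function.surjInv hf)
  left_inv t := by
    ext x y
    simp [Setoid.comap_rel, Function.surjInv_eq]
  right_inv s := by
    ext x y
    have h (z : α) : s.1 (Function.surjInv hf (f z)) z := s.2 _ _ (Function.surjInv_eq hf _)
    exact ⟨fun hxy => s.1.trans' (s.1.symm' (h x)) (s.1.trans' hxy (h y)),
      fun hxy => s.1.trans' (h x) (s.1.trans' hxy (s.1.symm' (h y)))⟩

/-- The class of `x` contains an element below every element of the class of `y`. -/
def ClassLT {α : Type*} [LT α] (s : Setoid α) (x y : α) : Prop :=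
  ∃ z, s z x ∧ ∀ w, s w y → z < w

theorem classLT_iff_not {α : Type*} [LinearOrder α] [Finite α] (s : Setoid α) (x y : α) :
    s.ClassLT y x ↔ ¬ s x y ∧ ¬ s.ClassLT x y := by
  constructor
  · rintro ⟨z, hz, hzw⟩
    refine ⟨fun h => (hzw z (s.trans' hz (s.symm' h))).false, ?_⟩
    rintro ⟨w, hw, hwz⟩
    exact lt_asymm (hzw w hw) (hwz z hz)
  · rintro ⟨hne, hlt⟩
    obtain ⟨z, hz, hmin⟩ := Set.exists_min_image {z | s z y} id (Set.toFinite _) ⟨y, s.refl' y⟩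
    refine ⟨z, hz, fun w hw => ?_⟩
    by_contra hzw
    refine hlt ⟨w, hw, fun u hu => ?_⟩
    refine lt_of_le_of_ne ((not_lt.1 hzw).trans (hmin u hu)) ?_
    rintro rfl
    exact hne (s.trans' (s.symm' hw) hu)

end Setoid

section Collapse

variable {α : Type*}

/-- Send `A` to `⊤`, the rest of `I` to `p`, and fix all other elements. -/
noncomputable def collapseTop (I A : Set α) (p : α) (x : α) : WithTop {x : α // x ∉ I ∨ x = p} :=
  if x ∈ A then ⊤ else if h : x ∈ I then ((⟨p, Or.inr rfl⟩ : {x : α // x ∉ I ∨ x = p}) : WithTop _)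
  else ((⟨x, Or.inl h⟩ : {x : α // x ∉ I ∨ x = p}) : WithTop _)

variable {I A : Set α} {p : α}

theorem collapseTop_of_mem {x : α} (hx : x ∈ A) : collapseTop I A p x = ⊤ := if_pos hx

theorem collapseTop_of_mem_diff {x : α} (hx : x ∈ I) (hxA : x ∉ A) :
    collapseTop I A p x = ((⟨p, Or.inr rfl⟩ : {x : α // x ∉ I ∨ x = p}) : WithTop _) := by
  simp [collapseTop, hx, hxA]

theorem collapseTop_coe (hA : A ⊆ I) (hp : p ∈ I) (hpA : p ∉ A) (x : {x : α // x ∉ I ∨ x = p}) :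
    collapseTop I A p x = (x : WithTop _) := by
  obtain ⟨x, hx | rfl⟩ := x
  · have : x ∉ A := fun h => hx (hA h)
    simp [collapseTop, hx, this]
  · exact collapseTop_of_mem_diff hp hpA

theorem collapseTop_surjective (hA : A ⊆ I) (hp : p ∈ I) (hpA : p ∉ A) (hne : A.Nonempty) :
    Function.Surjective (collapseTop I A p) := by
  intro y
  induction y with
  | top => exact hne.imp fun _ => collapseTop_of_mem
  | coe y => exact ⟨y, collapseTop_coe hA hp hpA y⟩

theorem collapseTop_eq_iff (hA : A ⊆ I) (hp : p ∈ I) (x y : α) :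
    collapseTop I A p x = collapseTop I A p y ↔ x = y ∨ x ∈ I ∧ y ∈ I ∧ (x ∈ A ↔ y ∈ A) := by
  have hxA := @hA x
  have hyA := @hA y
  by_cases hx : x ∈ A <;> by_cases hy : y ∈ A <;> by_cases hx' : x ∈ I <;> by_cases hy' : y ∈ I <;>
    simp_all [collapseTop] <;> grind

theorem classLT_comap_collapseTop [LinearOrder α] (hp : IsLeast I p) (hA : A ⊆ I) (hpA : p ∉ A)
    {q : α} (hq : q ∈ A) (t : Setoid (WithTop {x : α // x ∉ I ∨ x = p})) :
    (t.comap (collapseTop I A p)).ClassLT p q ↔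
      t.ClassLT ((⟨p, Or.inr rfl⟩ : {x : α // x ∉ I ∨ x = p}) : WithTop _) ⊤ := by
  have hlt (w : α) (hw : w ∈ A) : p < w :=
    lt_of_le_of_ne (hp.2 (hA hw)) (fun h => hpA (h ▸ hw))
  simp only [Setoid.ClassLT, Setoid.comap_rel, collapseTop_of_mem hq, collapseTop_of_mem_diff hp.1 hpA]
  constructor
  · rintro ⟨z, hz, hzw⟩
    have hzA : z ∉ A := fun h => (hzw z (by rw [collapseTop_of_mem h])).false
    obtain ⟨z', hz', hle⟩ : ∃ z' : {x : α // x ∉ I ∨ x = p},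
        collapseTop I A p z = (z' : WithTop _) ∧ (z' : α) ≤ z := by
      by_cases h : z ∈ I
      · exact ⟨_, collapseTop_of_mem_diff h hzA, hp.2 h⟩
      · exact ⟨⟨z, Or.inl h⟩, by simp [collapseTop, h, hzA], le_rfl⟩
    refine ⟨z', hz' ▸ hz, fun w hw => ?_⟩
    induction w with
    | top => exact WithTop.coe_lt_top _
    | coe w =>
      refine WithTop.coe_lt_coe.2 (Subtype.coe_lt_coe.1 (hle.trans_lt (hzw w ?_)))
      rwa [collapseTop_coe hA hp.1 hpA]
  · rintro ⟨z, hz, hzw⟩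
    induction z with
    | top => exact absurd (hzw ⊤ (t.refl' _)) (lt_irrefl _)
    | coe z =>
      refine ⟨min z p, ?_, fun w hw => ?_⟩
      · rcases min_choice (z : α) p with h | h <;> rw [h]
        · rwa [collapseTop_coe hA hp.1 hpA]
        · rw [collapseTop_of_mem_diff hp.1 hpA]
      · by_cases hwA : w ∈ A
        · exact (min_le_right _ _).trans_lt (hlt w hwA)
        · have h := hzw _ hw
          refine (min_le_left _ _).trans_lt ?_
          by_cases hwI : w ∈ I
          · rw [collapseTop_of_mem_diff hwI hwA] at h
            exact lt_of_lt_of_le (Subtype.coe_lt_coe.2 (WithTop.coe_lt_coe.1 h)) (hp.2 hwI)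
          · simp only [collapseTop, hwI, hwA, if_false, dif_neg, not_false_eq_true] at h
            exact Subtype.coe_lt_coe.2 (WithTop.coe_lt_coe.1 h)

theorem natCard_setoid_comap_collapseTop [LinearOrder α] (hp : IsLeast I p) (hA : A ⊆ I) (hpA : p ∉ A)
    (hne : A.Nonempty) {R : Setoid α → Prop}
    {R' : Setoid (WithTop {x : α // x ∉ I ∨ x = p}) → Prop}
    (hR : ∀ t, R (t.comap (collapseTop I A p)) ↔ R' t) :
    Nat.card {s : Setoid α // (∀ x ∈ I, ∀ y ∈ I, (x ∈ A ↔ y ∈ A) → s x y) ∧ R s} =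
      Nat.card {t // R' t} := by
  let e := Setoid.comapEquivOfSurjective _ (collapseTop_surjective hA hp.1 hpA hne)
  have h (s : Setoid α) : (∀ x ∈ I, ∀ y ∈ I, (x ∈ A ↔ y ∈ A) → s x y) ↔
      ∀ x y, collapseTop I A p x = collapseTop I A p y → s x y := by
    simp only [collapseTop_eq_iff hA hp.1]
    refine ⟨fun h x y hxy => ?_, fun h x hx y hy hxy => h x y (Or.inr ⟨hx, hy, hxy⟩)⟩
    rcases hxy with rfl | ⟨hx, hy, hxy⟩
    exacts [s.refl' x, h x hx y hy hxy]
  simp only [h]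
  exact Nat.card_congr ((Equiv.subtypeSubtypeEquivSubtypeInter _ R).symm.trans
    (e.subtypeEquiv fun t => (hR t).symm).symm)

theorem natCard_setoid_classLT_add [LinearOrder α] [Finite α] {A' : Set α} (hp : IsLeast I p)
    (hA : A ⊆ I) (hpA : p ∉ A) {q : α} (hq : q ∈ A)
    (hA' : A' ⊆ I) (hpA' : p ∉ A') {q' : α} (hq' : q' ∈ A') :
    Nat.card {s : Setoid α // (∀ x ∈ I, ∀ y ∈ I, (x ∈ A ↔ y ∈ A) → s x y) ∧ s.ClassLT p q} +
      Nat.card {s : Setoid α // (∀ x ∈ I, ∀ y ∈ I, (x ∈ A' ↔ y ∈ A') → s x y) ∧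
        s.ClassLT q' p} + Nat.card (Setoid {x : α // x ∉ I ∨ x = p}) =
      Nat.card (Setoid (WithTop {x : α // x ∉ I ∨ x = p})) := by
  let P : {x : α // x ∉ I ∨ x = p} := ⟨p, Or.inr rfl⟩
  have : Finite (WithTop {x : α // x ∉ I ∨ x = p}) :=
    inferInstanceAs (Finite (Option {x : α // x ∉ I ∨ x = p}))
  rw [natCard_setoid_comap_collapseTop hp hA hpA ⟨q, hq⟩ (classLT_comap_collapseTop hp hA hpA hq),
    natCard_setoid_comap_collapseTop hp hA' hpA' ⟨q', hq'⟩
      (R' := fun t => ¬ t (P : WithTop _) ⊤ ∧ ¬ t.ClassLT (P : WithTop _) ⊤)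
      (fun t => by
        rw [Setoid.classLT_iff_not, classLT_comap_collapseTop hp hA' hpA' hq', Setoid.comap_rel,
          collapseTop_of_mem hq', collapseTop_of_mem_diff hp.1 hpA']),
    Nat.card_congr (Setoid.comapEquivOfSurjective (WithTop.untopD P)
      (fun y => ⟨y, rfl⟩))]
  have hmerge (t : Setoid (WithTop {x : α // x ∉ I ∨ x = p})) :
      (∀ x y, WithTop.untopD P x = WithTop.untopD P y → t x y) ↔ t (P : WithTop _) ⊤ := by
    refine ⟨fun h => h _ _ rfl, fun h x y hxy => ?_⟩
    induction x with
    | top =>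
      induction y with
      | top => exact t.refl' _
      | coe y => obtain rfl : P = y := hxy; exact t.symm' h
    | coe x =>
      induction y with
      | top => obtain rfl : x = P := hxy; exact h
      | coe y => obtain rfl : x = y := hxy; exact t.refl' _
  simp only [hmerge]
  have hsplit (X : Type _) [Finite X] (a b : X → Prop) (hab : ∀ x, a x → ¬ b x) :
      Nat.card {x // a x} + Nat.card {x // ¬ b x ∧ ¬ a x} + Nat.card {x // b x} = Nat.card X := by
    have := Fintype.ofFinite X
    simp only [Nat.card_eq_fintype_card, Fintype.card_subtype]
    rw [← Finset.card_union_of_disjoint, ← Finset.card_union_of_disjoint, ← Finset.card_univ]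
    · congr 1; ext x; simp; tauto
    · simp only [Finset.disjoint_left]; simp; grind
    · simp only [Finset.disjoint_left]; simp; grind
  exact hsplit _ _ _ fun t ht htP => ((Setoid.classLT_iff_not t _ _).1 ht).1 (t.symm' htP)

end Collapse

section Partitions

variable {n : ℕ}

theorem mem_partitions {P : Finset (Finset ℕ)} : P ∈ partitions n ↔ IsPartition P (seg n) := by
  simp only [partitions, Finset.mem_filter, and_iff_right_iff_imp, Finset.mem_powerset]
  intro h B hB
  rw [Finset.mem_powerset, ← h.2.2]
  exact Finset.subset_biUnion_of_mem id hB

theorem IsPartition.eq_of_mem {P : Finset (Finset ℕ)} {S : Finset ℕ} (h : IsPartition P S)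
    {B C : Finset ℕ} (hB : B ∈ P) (hC : C ∈ P) {x : ℕ} (hxB : x ∈ B) (hxC : x ∈ C) : B = C := by
  by_contra hne
  exact Finset.disjoint_left.1 (h.2.1 B hB C hC hne) hxB hxC

theorem IsPartition.mem_of_mem {P : Finset (Finset ℕ)} {S : Finset ℕ} (h : IsPartition P S)
    {B : Finset ℕ} (hB : B ∈ P) {x : ℕ} (hx : x ∈ B) : x ∈ S := by
  rw [← h.2.2]
  exact Finset.mem_biUnion.2 ⟨B, hB, hx⟩

theorem IsPartition.exists_mem {P : Finset (Finset ℕ)} {S : Finset ℕ} (h : IsPartition P S)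
    {x : ℕ} (hx : x ∈ S) : ∃ B ∈ P, x ∈ B := by
  rw [← h.2.2] at hx
  exact Finset.mem_biUnion.1 hx

theorem IsPartition.blockOf_eq {P : Finset (Finset ℕ)} {S : Finset ℕ} (h : IsPartition P S)
    {B : Finset ℕ} (hB : B ∈ P) {x : ℕ} (hx : x ∈ B) : blockOf P x = B := by
  have : P.filter (fun B => x ∈ B) = {B} := by
    ext C
    simp only [Finset.mem_filter, Finset.mem_singleton]
    exact ⟨fun hC => h.eq_of_mem hC.1 hB hC.2 hx, fun hC => hC ▸ ⟨hB, hx⟩⟩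
  simp [blockOf, this]

/-- The equivalence relation on `S` whose classes are the blocks of `P`. -/
def IsPartition.toSetoid {P : Finset (Finset ℕ)} {S : Finset ℕ} (h : IsPartition P S) :
    Setoid S where
  r x y := ∃ B ∈ P, (x : ℕ) ∈ B ∧ (y : ℕ) ∈ B
  iseqv := by
    refine ⟨fun x => ?_, ?_, ?_⟩
    · obtain ⟨B, hB, hx⟩ := h.exists_mem x.2
      exact ⟨B, hB, hx, hx⟩
    · rintro x y ⟨B, hB, hx, hy⟩
      exact ⟨B, hB, hy, hx⟩
    · rintro x y z ⟨B, hB, hx, hy⟩ ⟨C, hC, hy', hz⟩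
      exact ⟨B, hB, hx, h.eq_of_mem hB hC hy hy' ▸ hz⟩

theorem IsPartition.toSetoid_rel {P : Finset (Finset ℕ)} {S : Finset ℕ} (h : IsPartition P S)
    (x y : S) : h.toSetoid x y ↔ ∃ B ∈ P, (x : ℕ) ∈ B ∧ (y : ℕ) ∈ B := Iff.rfl

theorem IsPartition.mem_iff_toSetoid {P : Finset (Finset ℕ)} {S : Finset ℕ} (h : IsPartition P S)
    (B : Finset ℕ) : B ∈ P ↔ ∃ x : S, ∀ y : ℕ, y ∈ B ↔ ∃ hy : y ∈ S, h.toSetoid x ⟨y, hy⟩ := by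
  constructor
  · intro hB
    obtain ⟨x, hx⟩ := Finset.nonempty_iff_ne_empty.2 (fun he => h.1 (he ▸ hB))
    refine ⟨⟨x, h.mem_of_mem hB hx⟩, fun y => ⟨fun hy => ⟨h.mem_of_mem hB hy, B, hB, hx, hy⟩, ?_⟩⟩
    rintro ⟨_, C, hC, hxC, hyC⟩
    exact h.eq_of_mem hC hB hxC hx ▸ hyC
  · rintro ⟨x, hx⟩
    obtain ⟨C, hC, hxC⟩ := h.exists_mem x.2
    suffices B = C from this ▸ hC
    ext y
    rw [hx]
    constructor
    · rintro ⟨_, D, hD, hxD, hyD⟩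
      exact h.eq_of_mem hD hC hxD hxC ▸ hyD
    · exact fun hy => ⟨h.mem_of_mem hC hy, C, hC, hxC, hy⟩

theorem exists_isPartition_toSetoid_eq {S : Finset ℕ} (s : Setoid S) :
    ∃ (P : Finset (Finset ℕ)) (h : IsPartition P S), h.toSetoid = s := by
  let b (x : S) : Finset ℕ := (Finset.univ.filter fun y => s x y).map (Function.Embedding.subtype _)
  have hb (x : S) (y : ℕ) : y ∈ b x ↔ ∃ hy : y ∈ S, s x ⟨y, hy⟩ := by
    simp [b]
  have hself (x : S) : (x : ℕ) ∈ b x := (hb _ _).2 ⟨x.2, s.refl' x⟩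
  have h : IsPartition (Finset.univ.image b) S := by
    refine ⟨?_, ?_, ?_⟩
    · simp only [Finset.mem_image, Finset.mem_univ, true_and, not_exists]
      exact fun x hx => Finset.notMem_empty _ (hx ▸ hself x)
    · simp only [Finset.mem_image, Finset.mem_univ, true_and]
      rintro _ ⟨x, rfl⟩ _ ⟨y, rfl⟩ hne
      refine Finset.disjoint_left.2 fun z hx hy => hne ?_
      obtain ⟨hz, hxz⟩ := (hb _ _).1 hx
      obtain ⟨_, hyz⟩ := (hb _ _).1 hy
      ext w
      simp only [hb]
      refine exists_congr fun hw => ⟨fun hxw => ?_, fun hyw => ?_⟩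
      · exact s.trans' hyz (s.trans' (s.symm' hxz) hxw)
      · exact s.trans' hxz (s.trans' (s.symm' hyz) hyw)
    · ext y
      simp only [Finset.mem_biUnion, Finset.mem_image, Finset.mem_univ, true_and, id]
      constructor
      · rintro ⟨_, ⟨x, rfl⟩, hy⟩
        exact ((hb _ _).1 hy).1
      · exact fun hy => ⟨_, ⟨⟨y, hy⟩, rfl⟩, hself _⟩
  refine ⟨_, h, Setoid.ext fun x y => ?_⟩
  rw [h.toSetoid_rel]
  simp only [Finset.mem_image, Finset.mem_univ, true_and]
  constructor
  · rintro ⟨_, ⟨z, rfl⟩, hx, hy⟩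
    exact s.trans' (s.symm' ((hb _ _).1 hx).2) ((hb _ _).1 hy).2
  · exact fun hxy => ⟨_, ⟨x, rfl⟩, hself x, (hb _ _).2 ⟨y.2, hxy⟩⟩

/-- Set partitions of `[n]` are the equivalence relations on `[n]`. -/
noncomputable def partitionsEquivSetoid (n : ℕ) : partitions n ≃ Setoid (seg n) :=
  Equiv.ofBijective (fun P => (mem_partitions.1 P.2).toSetoid) <| by
    constructor
    · intro P Q h
      ext B
      rw [(mem_partitions.1 P.2).mem_iff_toSetoid, (mem_partitions.1 Q.2).mem_iff_toSetoid]
      simp only at h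
      rw [h]
    · intro s
      obtain ⟨P, h, hs⟩ := exists_isPartition_toSetoid_eq s
      exact ⟨⟨P, mem_partitions.2 h⟩, hs⟩

theorem natCard_setoid_eq_bell {α : Type*} [Finite α] (h : Nat.card α = n) :
    Nat.card (Setoid α) = bell n := by
  obtain ⟨e⟩ : Nonempty (α ≃ seg n) := by
    rw [← Finite.card_eq, h, Nat.card_eq_finsetCard]
    simp [seg]
  rw [bell, ← Nat.card_eq_finsetCard, Nat.card_congr (partitionsEquivSetoid n),
    Nat.card_congr (Setoid.comapEquivOfSurjective e e.surjective)]
  refine Nat.card_congr (Equiv.subtypeUnivEquiv fun s x y hxy => ?_).symm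
  rw [e.injective hxy]

theorem rgf_lt_rgf {P : Finset (Finset ℕ)} {S : Finset ℕ} (h : IsPartition P S) {x y : S}
    (hxy : h.toSetoid.ClassLT x y) : rgf P x < rgf P y := by
  obtain ⟨z, ⟨B, hB, hzB, hxB⟩, hz⟩ := hxy
  obtain ⟨C, hC, hyC⟩ := h.exists_mem y.2
  rw [rgf, rgf, h.blockOf_eq hB hxB, h.blockOf_eq hC hyC]
  have hlt : B.min < C.min := by
    obtain ⟨w, hw⟩ := Finset.min_of_mem hyC
    rw [hw]
    refine (Finset.min_le hzB).trans_lt (WithTop.coe_lt_coe.2 ?_)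
    have hwC := Finset.mem_of_min hw
    exact hz ⟨w, h.mem_of_mem hC hwC⟩ ⟨C, hC, hwC, hyC⟩
  refine Finset.card_lt_card (Finset.ssubset_iff_of_subset ?_ |>.2 ⟨C, ?_, ?_⟩)
  · exact Finset.monotone_filter_right _ fun D _ hD => hD.trans hlt.le
  · exact Finset.mem_filter.2 ⟨hC, le_rfl⟩
  · exact fun hCB => hlt.not_ge (Finset.mem_filter.1 hCB).2

theorem rgf_eq_rgf {P : Finset (Finset ℕ)} {S : Finset ℕ} (h : IsPartition P S) {x y : S}
    (hxy : h.toSetoid x y) : rgf P x = rgf P y := by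
  obtain ⟨B, hB, hx, hy⟩ := hxy
  rw [rgf, rgf, h.blockOf_eq hB hx, h.blockOf_eq hB hy]

theorem rgf_lt_rgf_iff {P : Finset (Finset ℕ)} {S : Finset ℕ} (h : IsPartition P S) {x y : S} :
    rgf P x < rgf P y ↔ h.toSetoid.ClassLT x y := by
  refine ⟨fun hlt => ?_, rgf_lt_rgf h⟩
  rw [Setoid.classLT_iff_not]
  exact ⟨fun hyx => hlt.ne' (rgf_eq_rgf h hyx), fun hyx => lt_asymm hlt (rgf_lt_rgf h hyx)⟩

theorem rgf_eq_rgf_iff {P : Finset (Finset ℕ)} {S : Finset ℕ} (h : IsPartition P S) {x y : S} :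
    rgf P x = rgf P y ↔ h.toSetoid x y := by
  refine ⟨fun heq => ?_, rgf_eq_rgf h⟩
  by_contra hne
  by_cases hlt : h.toSetoid.ClassLT x y
  · exact (rgf_lt_rgf h hlt).ne heq
  · exact (rgf_lt_rgf h ((Setoid.classLT_iff_not _ _ _).2 ⟨hne, hlt⟩)).ne' heq

end Partitions

section Occurrences

variable {n r : ℕ} {σ : Fin r → ℕ}

theorem TwoPattern.exists_letters_iff (hσ : TwoPattern σ) {u v : Fin r} (hu : σ u = 1)
    (hv : σ v = 2) (w : Fin r → ℕ) :
    (∃ a b, a < b ∧ ∀ t, (σ t = 1 → w t = a) ∧ (σ t = 2 → w t = b)) ↔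
      (∀ t t', σ t = σ t' → w t = w t') ∧ w u < w v := by
  constructor
  · rintro ⟨a, b, hab, h⟩
    refine ⟨fun t t' htt => ?_, ?_⟩
    · rcases hσ.1 t with ht | ht
      · rw [(h t).1 ht, (h t').1 (htt ▸ ht)]
      · rw [(h t).2 ht, (h t').2 (htt ▸ ht)]
    · rwa [(h u).1 hu, (h v).2 hv]
  · rintro ⟨h, hlt⟩
    exact ⟨w u, w v, hlt, fun t => ⟨fun ht => h _ _ (ht.trans hu.symm),
      fun ht => h _ _ (ht.trans hv.symm)⟩⟩

theorem occ_eq_natCard (hσ : TwoPattern σ) {u v : Fin r} (hu : σ u = 1) (hv : σ v = 2)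
    (P : partitions n) :
    occ n σ P = Nat.card {i : Fin r ↪o seg n //
      (∀ t t', σ t = σ t' → partitionsEquivSetoid n P (i t) (i t')) ∧
        (partitionsEquivSetoid n P).ClassLT (i u) (i v)} := by
  have h := mem_partitions.1 P.2
  symm
  refine Nat.card_eq_of_bijective (fun i => ⟨fun t => i.1 t, ?_, fun t => (i.1 t).2, ?_⟩) ⟨?_, ?_⟩
  · exact fun a b hab => i.1.strictMono hab
  · rw [hσ.exists_letters_iff hu hv (fun t => rgf P (i.1 t))]
    simp only [rgf_lt_rgf_iff h, rgf_eq_rgf_iff h]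
    exact i.2
  · intro i j hij
    ext t
    exact congrFun (congrArg Subtype.val hij) t
  · rintro ⟨i, hi, hmem, hw⟩
    refine ⟨⟨OrderEmbedding.ofStrictMono (fun t => ⟨i t, hmem t⟩) fun a b hab => hi hab, ?_⟩, rfl⟩
    rw [hσ.exists_letters_iff hu hv (fun t => rgf P (i t))] at hw
    exact ⟨fun t t' htt => (rgf_eq_rgf_iff h).1 (hw.1 t t' htt), (rgf_lt_rgf_iff h).1 hw.2⟩

theorem sum_natCard_subtype_comm {ι κ : Type*} [Fintype ι] [Fintype κ] (R : ι → κ → Prop) :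
    ∑ x, Nat.card {y // R x y} = ∑ y, Nat.card {x // R x y} := by
  simp only [Nat.card_eq_fintype_card, Fintype.card_subtype, Finset.card_filter]
  exact Finset.sum_comm

theorem sum_occ_eq_sum_natCard (hσ : TwoPattern σ) {u v : Fin r} (hu : σ u = 1) (hv : σ v = 2) :
    ∑ P ∈ partitions n, occ n σ P = ∑ i : Fin r ↪o seg n,
      Nat.card {s : Setoid (seg n) //
        (∀ t t', σ t = σ t' → s (i t) (i t')) ∧ s.ClassLT (i u) (i v)} := by
  have := Fintype.ofFinite (Setoid (seg n))
  rw [← sum_natCard_subtype_comm (fun (s : Setoid (seg n)) (i : Fin r ↪o seg n) =>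
    (∀ t t', σ t = σ t' → s (i t) (i t')) ∧ s.ClassLT (i u) (i v)), ← Finset.sum_coe_sort]
  exact Fintype.sum_equiv (partitionsEquivSetoid n) _ _ fun P => occ_eq_natCard hσ hu hv P

theorem TwoPattern.forall_rel_iff {α : Type*} [LinearOrder α] (hσ : TwoPattern σ)
    (i : Fin r ↪o α) {c : ℕ} (hc : c = 1 ∨ c = 2) (s : Setoid α) :
    (∀ t t', σ t = σ t' → s (i t) (i t')) ↔ ∀ x ∈ Set.range i, ∀ y ∈ Set.range i,
      (x ∈ i '' {t | σ t = c} ↔ y ∈ i '' {t | σ t = c}) → s x y := by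
  simp only [Set.forall_mem_range, i.injective.mem_set_image, Set.mem_ofPred_eq]
  refine forall₂_congr fun t t' => ?_
  have : σ t = σ t' ↔ (σ t = c ↔ σ t' = c) := by
    rcases hσ.1 t with h | h <;> rcases hσ.1 t' with h' | h' <;> rcases hc with rfl | rfl <;>
      simp [h, h']
  rw [this]

theorem natCard_compl_range_or {α : Type*} [Finite α] (f : Fin r → α) (hf : Function.Injective f)
    (z : Fin r) : Nat.card {x : α // x ∉ Set.range f ∨ x = f z} = Nat.card α + 1 - r := by
  have := Fintype.ofFinite α
  have hle : r ≤ Fintype.card α := by simpa using Fintype.card_le_of_injective f hf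
  have hset : (Finset.univ.filter fun x : α => x ∉ Set.range f ∨ x = f z) =
      insert (f z) (Finset.univ.image f)ᶜ := by
    ext x; simp [or_comm]
  rw [Nat.card_eq_fintype_card, Nat.card_eq_fintype_card, Fintype.card_subtype, hset,
    Finset.card_insert_of_notMem (by simp), Finset.card_compl, Finset.card_image_of_injective _ hf,
    Finset.card_univ, Fintype.card_fin]
  omega

theorem natCard_occurrences_add {τ : Fin r → ℕ} (hσ : TwoPattern σ) (hτ : TwoPattern τ)
    (hn : r ≤ n) {z v w : Fin r} (hz : ∀ t, z ≤ t) (hσz : σ z = 1) (hσv : σ v = 2)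
    (hτz : τ z = 2) (hτw : τ w = 1) (i : Fin r ↪o seg n) :
    Nat.card {s : Setoid (seg n) //
        (∀ t t', σ t = σ t' → s (i t) (i t')) ∧ s.ClassLT (i z) (i v)} +
      Nat.card {s : Setoid (seg n) //
        (∀ t t', τ t = τ t' → s (i t) (i t')) ∧ s.ClassLT (i w) (i z)} +
      bell (n + 1 - r) = bell (n + 2 - r) := by
  have hcard : Nat.card {x : seg n // x ∉ Set.range i ∨ x = i z} = n + 1 - r := by
    rw [natCard_compl_range_or i i.injective z, Nat.card_eq_finsetCard]
    simp [seg]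
  have hcard' : Nat.card (WithTop {x : seg n // x ∉ Set.range i ∨ x = i z}) = n + 2 - r := by
    have := Finite.card_option (α := {x : seg n // x ∉ Set.range i ∨ x = i z})
    rw [hcard] at this
    exact this.trans (by omega)
  have : Finite (WithTop {x : seg n // x ∉ Set.range i ∨ x = i z}) :=
    inferInstanceAs (Finite (Option {x : seg n // x ∉ Set.range i ∨ x = i z}))
  rw [← natCard_setoid_eq_bell hcard, ← natCard_setoid_eq_bell hcard']
  simp only [hσ.forall_rel_iff i (Or.inr rfl : 2 = 1 ∨ 2 = 2),
    hτ.forall_rel_iff i (Or.inl rfl : 1 = 1 ∨ 1 = 2)]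
  refine natCard_setoid_classLT_add ⟨Set.mem_range_self z, ?_⟩
    (Set.image_subset_range _ _) ?_ (Set.mem_image_of_mem _ hσv)
    (Set.image_subset_range _ _) ?_ (Set.mem_image_of_mem _ hτw)
  · rintro _ ⟨t, rfl⟩
    exact i.monotone (hz t)
  · simp [hσz]
  · simp [hτz]

end Occurrences

/-- the connecting relation for the two kinds of 2-patterns. -/
theorem occ_connecting_relation {r : ℕ} (hr : 0 < r) (σ τ : Fin r → ℕ)
    (hσ : TwoPattern σ) (hτ : TwoPattern τ)
    (hσ1 : σ ⟨0, hr⟩ = 1) (hτ1 : τ ⟨0, hr⟩ = 2) (n : ℕ) (hn : r ≤ n) :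
    (∑ π ∈ partitions n, (occ n σ π : ℚ)) + (∑ π ∈ partitions n, (occ n τ π : ℚ))
      = (n.choose r : ℚ) * ((bell (n+2-r) : ℚ) - (bell (n+1-r) : ℚ)) := by
  obtain ⟨v, hv⟩ := hσ.2.2
  obtain ⟨w, hw⟩ := hτ.2.1
  have hz (t : Fin r) : (⟨0, hr⟩ : Fin r) ≤ t := Nat.zero_le t
  have hcard : Fintype.card (Fin r ↪o seg n) = n.choose r := by
    rw [← Nat.card_eq_fintype_card, Nat.card_congr Set.powersetCard.ofFinEmbEquiv,
      Set.powersetCard.card, Nat.card_eq_finsetCard]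
    simp [seg]
  have hsum : ∑ π ∈ partitions n, occ n σ π + ∑ π ∈ partitions n, occ n τ π +
      n.choose r * bell (n + 1 - r) = n.choose r * bell (n + 2 - r) := by
    rw [sum_occ_eq_sum_natCard hσ hσ1 hv, sum_occ_eq_sum_natCard hτ hw hτ1, ← hcard,
      ← smul_eq_mul, ← smul_eq_mul, ← Finset.card_univ, ← Finset.sum_const, ← Finset.sum_const,
      ← Finset.sum_add_distrib, ← Finset.sum_add_distrib]
    exact Finset.sum_congr rfl fun i _ =>
      natCard_occurrences_add hσ hτ hn hz hσ1 hv hτ1 hw i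
  have hsum' := congrArg (Nat.cast (R := ℚ)) hsum
  push_cast at hsum'
  linarith
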